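/- arXiv:2601.11765 — 2 statements merged into one kernel-verified Lean document; each statement's English description precedes it below -/
import Mathlib

section
/- Fix positive integers k and b and a (deterministic) level assignment ℓ_1,…,ℓ_n ∈ {1,2,3,…} such that for every level ℓ ≥ 1, C_{ℓ, min(2^ℓ·b, n)} < k. Then the quantities p_i = ∑_{ℓ ≥ 1 : C_{ℓ,i-1} < k} 2^{-ℓ} satisfy: p_i = 1 for every i ≤ 2b, and p_i ≥ b/i for every i > 2b. -/
/-- `levelCount n L ℓ i` is `C_{ℓ,i}`: the number of points among the first `i`
(i.e. those `j : Fin n` with `(j : ℕ) < i`) assigned to level `ℓ` by `L`. -/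
def levelCount (n : ℕ) (L : Fin n → ℕ) (ℓ : ℕ) (i : ℕ) : ℕ :=
  (Finset.univ.filter (fun j : Fin n => (j : ℕ) < i ∧ L j = ℓ)).card

/-- `pVal n k L m` is `p_i` for the point with `m = i − 1` previous points:
`∑_{ℓ ≥ 1 : C_{ℓ,m} < k} 2^{−ℓ}` (the sum over levels `ℓ ≥ 1` is written as a
`tsum` over `ℓ : ℕ` of the term at level `ℓ + 1`). -/
noncomputable def pVal (n k : ℕ) (L : Fin n → ℕ) (m : ℕ) : ℝ :=
  ∑' ℓ : ℕ, if levelCount n L (ℓ + 1) m < k then (1 / 2 : ℝ) ^ (ℓ + 1) else 0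

theorem levelCount_mono (n : ℕ) (L : Fin n → ℕ) (ℓ : ℕ) {i j : ℕ} (h : i ≤ j) :
    levelCount n L ℓ i ≤ levelCount n L ℓ j :=
  Finset.card_le_card fun x hx => by
    simp only [Finset.mem_filter, Finset.mem_univ, true_and] at hx ⊢
    exact ⟨hx.1.trans_le h, hx.2⟩

theorem hasSum_half_pow_add (t : ℕ) :
    HasSum (fun ℓ : ℕ => (1 / 2 : ℝ) ^ (ℓ + t + 1)) ((1 / 2) ^ t) := by
  have h := hasSum_geometric_two.mul_right ((1 / 2 : ℝ) ^ (t + 1))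
  have hterm : ∀ ℓ : ℕ, (1 / 2 : ℝ) ^ ℓ * (1 / 2) ^ (t + 1) = (1 / 2) ^ (ℓ + t + 1) :=
    fun ℓ => by rw [← pow_add, add_assoc]
  have hlim : 2 * (1 / 2 : ℝ) ^ (t + 1) = (1 / 2) ^ t := by ring
  simpa only [hterm, hlim] using h

/-- If every level above `t` is still open after `m` points, then `p ≥ 2^{-t}`. -/
theorem half_pow_le_pVal {n k : ℕ} {L : Fin n → ℕ} {m t : ℕ}
    (h : ∀ ℓ, t < ℓ → levelCount n L ℓ m < k) : (1 / 2 : ℝ) ^ t ≤ pVal n k L m := by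
  have hpow : Summable fun ℓ : ℕ => (1 / 2 : ℝ) ^ (ℓ + 1) := (hasSum_half_pow_add 0).summable
  set f : ℕ → ℝ := fun ℓ =>
    if levelCount n L (ℓ + 1) m < k then (1 / 2 : ℝ) ^ (ℓ + 1) else 0 with hf
  have hnonneg : ∀ ℓ, 0 ≤ f ℓ := fun ℓ => by
    simp only [hf]
    split_ifs <;> positivity
  have hsum : Summable f := hpow.of_nonneg_of_le hnonneg fun ℓ => by
    simp only [hf]
    split_ifs
    · exact le_rfl
    · positivity
  have htail : ∑' ℓ, f (ℓ + t) = (1 / 2) ^ t := by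
    rw [← (hasSum_half_pow_add t).tsum_eq]
    exact tsum_congr fun ℓ => if_pos (h _ (by omega))
  change _ ≤ ∑' ℓ, f ℓ
  rw [← hsum.sum_add_tsum_nat_add t, htail]
  exact le_add_of_nonneg_left (Finset.sum_nonneg fun ℓ _ => hnonneg ℓ)

theorem pVal_eq_one {n k : ℕ} {L : Fin n → ℕ} {m : ℕ}
    (h : ∀ ℓ, 0 < ℓ → levelCount n L ℓ m < k) : pVal n k L m = 1 := by
  have hone := (hasSum_half_pow_add 0).tsum_eq
  rw [pow_zero] at hone
  rw [← hone]
  exact tsum_congr fun ℓ => if_pos (h _ ℓ.succ_pos)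

/-- Fix positive integers `k` and `b` and a deterministic level assignment
`ℓ_1,…,ℓ_n ∈ {1,2,3,…}` such that for every level `ℓ ≥ 1`, `C_{ℓ, min(2^ℓ·b, n)} < k`.
Then `p_i = 1` for every `i ≤ 2b`, and `p_i ≥ b/i` for every `i > 2b`
(here `i ∈ {1,…,n}` is the 1-based point index, with `i − 1` previous points). -/
theorem stmt_8 (n k b : ℕ) (hk : 0 < k) (hb : 0 < b)
    (L : Fin n → ℕ) (hL : ∀ j, 1 ≤ L j)
    (hgood : ∀ ℓ : ℕ, 1 ≤ ℓ → levelCount n L ℓ (min (2 ^ ℓ * b) n) < k) :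
    ∀ i : ℕ, 1 ≤ i → i ≤ n →
      (i ≤ 2 * b → pVal n k L (i - 1) = 1) ∧
      (2 * b < i → (b : ℝ) / (i : ℝ) ≤ pVal n k L (i - 1)) := by
  intro i _ hin
  have hopen : ∀ t, i ≤ 2 ^ (t + 1) * b → ∀ ℓ, t < ℓ → levelCount n L ℓ (i - 1) < k := by
    intro t hit ℓ hℓ
    have hpow : 2 ^ (t + 1) * b ≤ 2 ^ ℓ * b :=
      Nat.mul_le_mul_right _ (Nat.pow_le_pow_right (by norm_num) hℓ)
    exact (levelCount_mono n L ℓ (by omega)).trans_lt (hgood ℓ (by omega))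
  refine ⟨fun hi => pVal_eq_one (hopen 0 (by simpa using hi)), fun hi => ?_⟩
  have hex : ∃ t, i ≤ 2 ^ (t + 1) * b :=
    ⟨i, (Nat.lt_two_pow_self.le.trans (Nat.pow_le_pow_right (by norm_num) i.le_succ)).trans
      (Nat.le_mul_of_pos_right _ hb)⟩
  obtain ⟨t, ht, hmin⟩ : ∃ t, i ≤ 2 ^ (t + 1) * b ∧ 2 ^ t * b ≤ i := by
    classical
    refine ⟨Nat.find hex, Nat.find_spec hex, ?_⟩
    rcases hs : Nat.find hex with _ | s
    · simp only [pow_zero, one_mul]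
      omega
    · exact (not_le.mp (Nat.find_min hex (m := s) (by omega))).le
  refine le_trans ?_ (half_pow_le_pVal (hopen t ht))
  have hmin' : (2 : ℝ) ^ t * b ≤ i := by exact_mod_cast hmin
  have hi0 : (0 : ℝ) < i := by exact_mod_cast (by omega : 0 < i)
  rw [one_div, inv_pow, div_le_iff₀ hi0, inv_mul_eq_div, le_div_iff₀ (by positivity)]
  linarith
end

section
/- (Martingale Bernstein inequality, deviation form.) Let {X_i}_{i=1}^n be a martingale difference sequence with respect to a filtration {F_i}_{i=1}^n, i.e. each X_i is F_i-measurable and E[X_i | F_{i-1}] = 0 almost surely. Assume |X_i| ≤ M almost surely for every i, and that the sum of conditional variances V = ∑_{i=1}^n E[X_i² | F_{i-1}] satisfies V ≤ σ² almost surely for a constant σ² ≥ 0. Then for any δ ∈ (0,1), Pr(|∑_{i=1}^n X_i| ≥ √(2σ²·log(2/δ)) + (2M/3)·log(2/δ)) ≤ δ. -/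
open MeasureTheory

lemma Real.exp_le_one_add_add_sq_div {u b : ℝ} (hu : |u| ≤ b) (hb : b < 3) :
    Real.exp u ≤ 1 + u + u ^ 2 / (2 * (1 - b / 3)) := by
  have hb0 : 0 ≤ b := (abs_nonneg u).trans hu
  have hexp : HasSum (fun k : ℕ ↦ u ^ (k + 2) / ((k + 2).factorial : ℝ))
      (Real.exp u - (1 + u)) := by
    have h := NormedSpace.expSeries_div_hasSum_exp u
    rw [← Real.exp_eq_exp_ℝ, ← hasSum_nat_add_iff' 2] at h
    simpa [Finset.sum_range_succ] using h
  have hgeom : HasSum (fun k : ℕ ↦ u ^ 2 / 2 * (b / 3) ^ k) (u ^ 2 / 2 * (1 - b / 3)⁻¹) :=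
    (hasSum_geometric_of_lt_one (by positivity) (by linarith)).mul_left _
  have hle := hasSum_le (fun k ↦ ?_) hexp hgeom
  · have : u ^ 2 / (2 * (1 - b / 3)) = u ^ 2 / 2 * (1 - b / 3)⁻¹ := by
      rw [← div_div, div_eq_mul_inv (u ^ 2 / 2)]
    linarith
  · have hfac : (2 * 3 ^ k : ℝ) ≤ (k + 2).factorial := by
      have := Nat.factorial_mul_pow_le_factorial (m := 2) (n := k)
      rw [add_comm 2 k] at this
      exact_mod_cast this
    calc u ^ (k + 2) / ((k + 2).factorial : ℝ)
        ≤ |u| ^ (k + 2) / ((k + 2).factorial : ℝ) := by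
          refine div_le_div_of_nonneg_right ?_ (by positivity)
          exact (le_abs_self _).trans_eq (abs_pow u _)
      _ ≤ |u| ^ (k + 2) / (2 * 3 ^ k) := by gcongr
      _ = u ^ 2 / 2 * (|u| / 3) ^ k := by
          rw [pow_add, sq_abs, div_pow]
          field_simp
      _ ≤ u ^ 2 / 2 * (b / 3) ^ k := by gcongr

section Bernstein

variable {Ω : Type*} {m0 : MeasurableSpace Ω} {μ : Measure Ω} [IsProbabilityMeasure μ]

lemma integrable_exp_mul_of_abs_le {X : Ω → ℝ} {M t : ℝ} (hX : AEStronglyMeasurable X μ)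
    (hbdd : ∀ᵐ ω ∂μ, |X ω| ≤ M) (ht : 0 ≤ t) :
    Integrable (fun ω ↦ Real.exp (t * X ω)) μ := by
  refine Integrable.of_bound (Real.continuous_exp.comp_aestronglyMeasurable (hX.const_mul t))
    (Real.exp (t * M)) ?_
  filter_upwards [hbdd] with ω hω
  rw [Real.norm_eq_abs, Real.abs_exp]
  gcongr
  exact (le_abs_self _).trans hω

/-- Bernstein's bound on the conditional moment generating function of a bounded variable. -/
lemma condExp_exp_mul_le {m : MeasurableSpace Ω} (hm : m ≤ m0) {X : Ω → ℝ} {M t : ℝ}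
    (hX : AEStronglyMeasurable[m0] X μ) (hbdd : ∀ᵐ ω ∂μ, |X ω| ≤ M) (hmean : μ[X | m] =ᵐ[μ] 0)
    (ht : 0 ≤ t) (htM : t * M < 3) :
    ∀ᵐ ω ∂μ, (μ[fun ω ↦ Real.exp (t * X ω) | m]) ω
      ≤ Real.exp (t ^ 2 / (2 * (1 - t * M / 3)) * (μ[fun ω ↦ X ω ^ 2 | m]) ω) := by
  set v : ℝ := t ^ 2 / (2 * (1 - t * M / 3)) with hv
  have hXint : Integrable X μ := Integrable.of_bound hX M hbdd
  have hX2int : Integrable (fun ω ↦ X ω ^ 2) μ := by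
    refine Integrable.of_bound (hX.pow 2) (M ^ 2) ?_
    filter_upwards [hbdd] with ω hω
    rw [norm_pow, Real.norm_eq_abs]
    gcongr
  have hquad : Integrable ((fun _ ↦ (1 : ℝ)) + t • X) μ :=
    (integrable_const 1).add (hXint.smul t)
  have hmono := condExp_mono (m := m) (integrable_exp_mul_of_abs_le hX hbdd ht)
    (hquad.add (hX2int.smul v)) (by
      filter_upwards [hbdd] with ω hω
      have habs : |t * X ω| ≤ t * M := by
        rw [abs_mul, abs_of_nonneg ht]
        gcongr
      have h := Real.exp_le_one_add_add_sq_div habs htM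
      simp only [Pi.add_apply, Pi.smul_apply, smul_eq_mul]
      refine h.trans_eq ?_
      rw [hv]
      ring)
  filter_upwards [hmono, condExp_add hquad (hX2int.smul v) m,
    condExp_add (integrable_const (1 : ℝ)) (hXint.smul t) m, condExp_smul t X m,
    condExp_smul v (fun ω ↦ X ω ^ 2) m, hmean] with ω h1 h2 h3 h4 h5 h6
  simp only [Pi.add_apply, Pi.smul_apply, smul_eq_mul, Pi.zero_apply,
    condExp_const hm] at h1 h2 h3 h4 h5 h6
  rw [h2, h3, h4, h5, h6] at h1
  linarith [Real.add_one_le_exp (v * (μ[fun ω ↦ X ω ^ 2 | m]) ω)]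

/-- The exponential process compensated by the predictable quadratic variation has mean at most
one. -/
lemma integral_exp_sum_sub_condVar_le_one (ℱ : Filtration ℕ m0) {X : ℕ → Ω → ℝ} {M t : ℝ}
    (ht : 0 ≤ t) (htM : t * M < 3) (n : ℕ)
    (hmeas : ∀ i < n, StronglyMeasurable[ℱ (i + 1)] (X i))
    (hmds : ∀ i < n, μ[X i | ℱ i] =ᵐ[μ] 0)
    (hbdd : ∀ i < n, ∀ᵐ ω ∂μ, |X i ω| ≤ M) :
    Integrable (fun ω ↦ Real.exp (t * ∑ i ∈ Finset.range n, X i ω -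
      t ^ 2 / (2 * (1 - t * M / 3)) *
        ∑ i ∈ Finset.range n, (μ[fun ω ↦ X i ω ^ 2 | ℱ i]) ω)) μ ∧
    ∫ ω, Real.exp (t * ∑ i ∈ Finset.range n, X i ω -
      t ^ 2 / (2 * (1 - t * M / 3)) *
        ∑ i ∈ Finset.range n, (μ[fun ω ↦ X i ω ^ 2 | ℱ i]) ω) ∂μ ≤ 1 := by
  set v : ℝ := t ^ 2 / (2 * (1 - t * M / 3)) with hv
  have hv0 : 0 ≤ v := div_nonneg (sq_nonneg t) (by linarith)
  induction n with
  | zero => simp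
  | succ n ih =>
    obtain ⟨ihint, ihle⟩ := ih (fun i hi ↦ hmeas i (by omega)) (fun i hi ↦ hmds i (by omega))
      (fun i hi ↦ hbdd i (by omega))
    set W : ℕ → Ω → ℝ := fun i ↦ μ[fun ω ↦ X i ω ^ 2 | ℱ i] with hW
    set A : Ω → ℝ := fun ω ↦ Real.exp (t * ∑ i ∈ Finset.range n, X i ω -
      v * ∑ i ∈ Finset.range (n + 1), W i ω) with hA
    set E : Ω → ℝ := fun ω ↦ Real.exp (t * X n ω) with hE
    have hXn : AEStronglyMeasurable (X n) μ :=
      ((hmeas n (by omega)).mono (ℱ.le _)).aestronglyMeasurable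
    have hEint : Integrable E μ := integrable_exp_mul_of_abs_le hXn (hbdd n (by omega)) ht
    have hAmeas : StronglyMeasurable[ℱ n] A := by
      refine Real.continuous_exp.comp_stronglyMeasurable
        (((Finset.stronglyMeasurable_fun_sum _ fun i hi ↦ ?_).const_mul t).sub
          ((Finset.stronglyMeasurable_fun_sum _ fun i hi ↦ ?_).const_mul v))
      · rw [Finset.mem_range] at hi
        exact (hmeas i (by omega)).mono (ℱ.mono (by omega))
      · rw [Finset.mem_range] at hi
        exact stronglyMeasurable_condExp.mono (ℱ.mono (by omega))
    have hWnn : ∀ᵐ ω ∂μ, ∀ i, 0 ≤ W i ω :=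
      ae_all_iff.2 fun i ↦ condExp_nonneg (ae_of_all _ fun ω ↦ sq_nonneg (X i ω))
    have hXbdd : ∀ᵐ ω ∂μ, ∀ i, i < n → |X i ω| ≤ M :=
      ae_all_iff.2 fun i ↦ Filter.eventually_imp_distrib_left.2 fun hi ↦ hbdd i (by omega)
    have hAbdd : ∀ᵐ ω ∂μ, ‖A ω‖ ≤ Real.exp (t * ∑ i ∈ Finset.range n, M) := by
      filter_upwards [hWnn, hXbdd] with ω hWω hXω
      rw [Real.norm_eq_abs, Real.abs_exp]
      refine Real.exp_le_exp.2 ?_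
      have h1 : ∑ i ∈ Finset.range n, X i ω ≤ ∑ i ∈ Finset.range n, M :=
        Finset.sum_le_sum fun i hi ↦ (le_abs_self _).trans (hXω i (Finset.mem_range.1 hi))
      have h2 : 0 ≤ v * ∑ i ∈ Finset.range (n + 1), W i ω :=
        mul_nonneg hv0 (Finset.sum_nonneg fun i _ ↦ hWω i)
      linarith [mul_le_mul_of_nonneg_left h1 ht]
    have hAE : (fun ω ↦ Real.exp (t * ∑ i ∈ Finset.range (n + 1), X i ω -
        v * ∑ i ∈ Finset.range (n + 1), W i ω)) = A * E := by
      ext ω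
      rw [Pi.mul_apply, hA, hE, ← Real.exp_add, Finset.sum_range_succ (fun i ↦ X i ω)]
      ring_nf
    have hAEint : Integrable (A * E) μ :=
      hEint.bdd_mul ((hAmeas.mono (ℱ.le n)).aestronglyMeasurable) hAbdd
    have hpull : μ[A * E | ℱ n] =ᵐ[μ] A * μ[E | ℱ n] :=
      condExp_mul_of_stronglyMeasurable_left hAmeas hAEint hEint
    refine ⟨hAE ▸ hAEint, ?_⟩
    calc ∫ ω, Real.exp (t * ∑ i ∈ Finset.range (n + 1), X i ω -
          v * ∑ i ∈ Finset.range (n + 1), W i ω) ∂μ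
        = ∫ ω, (A * E) ω ∂μ := by rw [hAE]
      _ = ∫ ω, (μ[A * E | ℱ n]) ω ∂μ := (integral_condExp (ℱ.le n)).symm
      _ ≤ ∫ ω, Real.exp (t * ∑ i ∈ Finset.range n, X i ω -
          v * ∑ i ∈ Finset.range n, W i ω) ∂μ := by
        refine integral_mono_ae integrable_condExp ihint ?_
        filter_upwards [hpull, condExp_exp_mul_le (ℱ.le n) hXn (hbdd n (by omega))
          (hmds n (by omega)) ht htM] with ω h1 h2
        rw [h1, Pi.mul_apply]
        refine (mul_le_mul_of_nonneg_left h2 (Real.exp_pos _).le).trans_eq ?_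
        rw [← Real.exp_add, Finset.sum_range_succ (fun i ↦ W i ω)]
        simp only [hW, hv]
        ring_nf
      _ ≤ 1 := ihle

/-- Chernoff bound for martingales with bounded increments and bounded conditional variance. -/
lemma measure_sum_ge_le_exp_of_condVar_le (ℱ : Filtration ℕ m0) {X : ℕ → Ω → ℝ} {M t σ2 : ℝ}
    (ht : 0 ≤ t) (htM : t * M < 3) (n : ℕ)
    (hmeas : ∀ i < n, StronglyMeasurable[ℱ (i + 1)] (X i))
    (hmds : ∀ i < n, μ[X i | ℱ i] =ᵐ[μ] 0)
    (hbdd : ∀ i < n, ∀ᵐ ω ∂μ, |X i ω| ≤ M)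
    (hvar : ∀ᵐ ω ∂μ, ∑ i ∈ Finset.range n, (μ[fun ω' ↦ X i ω' ^ 2 | ℱ i]) ω ≤ σ2) (r : ℝ) :
    μ.real {ω | r ≤ ∑ i ∈ Finset.range n, X i ω}
      ≤ Real.exp (t ^ 2 / (2 * (1 - t * M / 3)) * σ2 - t * r) := by
  obtain ⟨hint, hle⟩ := integral_exp_sum_sub_condVar_le_one ℱ ht htM n hmeas hmds hbdd
  set v : ℝ := t ^ 2 / (2 * (1 - t * M / 3)) with hv
  have hv0 : 0 ≤ v := div_nonneg (sq_nonneg t) (by linarith)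
  have hmarkov := mul_meas_ge_le_integral_of_nonneg
    (ae_of_all μ fun ω ↦ (Real.exp_pos _).le) hint (Real.exp (t * r - v * σ2))
  have hsub : μ.real {ω | r ≤ ∑ i ∈ Finset.range n, X i ω} ≤
      μ.real {ω | Real.exp (t * r - v * σ2) ≤ Real.exp (t * ∑ i ∈ Finset.range n, X i ω -
        v * ∑ i ∈ Finset.range n, (μ[fun ω ↦ X i ω ^ 2 | ℱ i]) ω)} := by
    refine ENNReal.toReal_mono (measure_ne_top _ _) (measure_mono_ae ?_)
    filter_upwards [hvar] with ω hω hr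
    refine Real.exp_le_exp.2 ?_
    linarith [mul_le_mul_of_nonneg_left hω hv0, mul_le_mul_of_nonneg_left hr ht]
  have hinv : Real.exp (v * σ2 - t * r) = (Real.exp (t * r - v * σ2))⁻¹ := by
    rw [← Real.exp_neg, neg_sub]
  rw [hinv, ← one_div, le_div_iff₀' (Real.exp_pos _)]
  exact (mul_le_mul_of_nonneg_left hsub (Real.exp_pos _).le).trans (hmarkov.trans hle)

/-- Choice of the exponential parameter in Bernstein's inequality. -/
lemma exists_bernstein_exponent_le {M σ2 L : ℝ} (hM : 0 < M) (hσ2 : 0 ≤ σ2) (hL : 0 < L) :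
    ∃ t : ℝ, 0 ≤ t ∧ t * M < 3 ∧ t ^ 2 / (2 * (1 - t * M / 3)) * σ2
      - t * (Real.sqrt (2 * σ2 * L) + 2 * M / 3 * L) ≤ -L := by
  rcases hσ2.eq_or_lt with rfl | hσ
  · refine ⟨3 / (2 * M), by positivity, ?_, ?_⟩
    · field_simp
      norm_num
    · simp only [mul_zero, zero_mul, Real.sqrt_zero, zero_add, zero_sub]
      field_simp
      norm_num
  · set s := Real.sqrt (2 * σ2 * L) with hs
    have hs0 : 0 ≤ s := Real.sqrt_nonneg _
    have hs2 : s ^ 2 = 2 * σ2 * L := Real.sq_sqrt (by positivity)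
    set r := s + 2 * M / 3 * L with hr
    have hr0 : 0 < r := by positivity
    have hD : 0 < σ2 + M * r / 3 := by positivity
    refine ⟨r / (σ2 + M * r / 3), by positivity, ?_, ?_⟩
    · rw [div_mul_eq_mul_div, div_lt_iff₀ hD]
      linarith
    · have h1 : 1 - r / (σ2 + M * r / 3) * M / 3 = σ2 / (σ2 + M * r / 3) := by
        field_simp
        ring
      have h2 : (r / (σ2 + M * r / 3)) ^ 2 / (2 * (σ2 / (σ2 + M * r / 3))) * σ2
          - r / (σ2 + M * r / 3) * r = -(r ^ 2 / (2 * (σ2 + M * r / 3))) := by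
        field_simp
        ring
      rw [h1, h2, neg_le_neg_iff, le_div_iff₀ (by positivity)]
      have : 0 ≤ M * L * s := by positivity
      rw [hr]
      nlinarith

end Bernstein

/-- (Martingale Bernstein inequality, deviation form.)
Let `{X_i}_{i=1}^n` be a martingale difference sequence with respect to a filtration
`{F_i}`: each `X_i` is `F_i`-measurable and `E[X_i | F_{i−1}] = 0` a.s. Assume
`|X_i| ≤ M` a.s. for every `i`, and that `V = ∑_{i=1}^n E[X_i² | F_{i−1}] ≤ σ²` a.s.
Then for any `δ ∈ (0,1)`,
`Pr(|∑ X_i| ≥ √(2σ²·log(2/δ)) + (2M/3)·log(2/δ)) ≤ δ`.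
(We index by `i : ℕ`, `i < n`, so `X i` plays the role of `X_{i+1}`: it is
`ℱ (i+1)`-measurable and conditioned on `ℱ i`.) -/
theorem stmt_14 {Ω : Type*} {m0 : MeasurableSpace Ω} (μ : Measure Ω) [IsProbabilityMeasure μ]
    (ℱ : Filtration ℕ m0) (n : ℕ) (X : ℕ → Ω → ℝ)
    (M : ℝ) (hM : 0 < M) (σ2 : ℝ) (hσ2 : 0 ≤ σ2)
    (hmeas : ∀ i < n, StronglyMeasurable[ℱ (i + 1)] (X i))
    (hmds : ∀ i < n, μ[X i | ℱ i] =ᵐ[μ] 0)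
    (hbdd : ∀ i < n, ∀ᵐ ω ∂μ, |X i ω| ≤ M)
    (hvar : ∀ᵐ ω ∂μ, ∑ i ∈ Finset.range n, (μ[fun ω' => X i ω' ^ 2 | ℱ i]) ω ≤ σ2)
    (δ : ℝ) (hδ : δ ∈ Set.Ioo (0 : ℝ) 1) :
    μ {ω | Real.sqrt (2 * σ2 * Real.log (2 / δ)) + 2 * M / 3 * Real.log (2 / δ)
        ≤ |∑ i ∈ Finset.range n, X i ω|} ≤ ENNReal.ofReal δ := by
  obtain ⟨hδ0, hδ1⟩ := hδ
  have hL : 0 < Real.log (2 / δ) := Real.log_pos (by rw [lt_div_iff₀ hδ0]; linarith)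
  obtain ⟨t, ht, htM, hexp⟩ := exists_bernstein_exponent_le hM hσ2 hL
  set r := Real.sqrt (2 * σ2 * Real.log (2 / δ)) + 2 * M / 3 * Real.log (2 / δ) with hr
  have hbound : Real.exp (t ^ 2 / (2 * (1 - t * M / 3)) * σ2 - t * r) ≤ δ / 2 := by
    refine (Real.exp_le_exp.2 hexp).trans_eq ?_
    rw [Real.exp_neg, Real.exp_log (by positivity), inv_div]
  have hupper := (measure_sum_ge_le_exp_of_condVar_le ℱ ht htM n hmeas hmds hbdd hvar r).trans
    hbound
  have hlower := (measure_sum_ge_le_exp_of_condVar_le (μ := μ) ℱ (X := fun i ↦ -X i) ht htM n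
    (fun i hi ↦ (hmeas i hi).neg)
    (fun i hi ↦ by
      filter_upwards [condExp_neg (μ := μ) (X i) (ℱ i), hmds i hi] with ω h1 h2
      simp [h1, h2])
    (fun i hi ↦ by simpa using hbdd i hi) (by simpa using hvar) r).trans hbound
  have hsub : {ω | r ≤ |∑ i ∈ Finset.range n, X i ω|} ⊆
      {ω | r ≤ ∑ i ∈ Finset.range n, X i ω} ∪ {ω | r ≤ ∑ i ∈ Finset.range n, (-X i) ω} := by
    intro ω hω
    simpa [le_abs] using hω
  rw [← ofReal_measureReal]
  refine ENNReal.ofReal_le_ofReal ?_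
  linarith [measureReal_mono (μ := μ) hsub, measureReal_union_le (μ := μ)
    {ω | r ≤ ∑ i ∈ Finset.range n, X i ω} {ω | r ≤ ∑ i ∈ Finset.range n, (-X i) ω}]
end
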